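/- For every x ∈ ℝ^d and every r > 0, |η̄(x,r) − η(x)| ≤ 12 · d · exp(r²/d) · (‖x − m‖² + ‖x‖²) · (γ_d(x)^(−1) + γ_d(x − m)^(−1))^(2/d) · μ(B(x,r))^(2/d). -/

import Mathlib

open MeasureTheory Real

/-- Standard Gaussian density on `ℝ^d`. -/
noncomputable def stdGaussianDensity (d : ℕ) (x : EuclideanSpace ℝ (Fin d)) : ℝ :=
  (2 * π) ^ (-(d : ℝ) / 2) * Real.exp (-‖x‖ ^ 2 / 2)

/-- Regression function of the Gaussian translation model:
`η(x) = γ_d(x − m) / (γ_d(x) + γ_d(x − m))`. -/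
noncomputable def gaussEta (d : ℕ) (m : EuclideanSpace ℝ (Fin d))
    (x : EuclideanSpace ℝ (Fin d)) : ℝ :=
  stdGaussianDensity d (x - m) / (stdGaussianDensity d x + stdGaussianDensity d (x - m))

/-- Marginal (mixture) law of the design: density `(γ_d(x) + γ_d(x − m))/2`
with respect to Lebesgue measure. -/
noncomputable def gaussMixture (d : ℕ) (m : EuclideanSpace ℝ (Fin d)) :
    Measure (EuclideanSpace ℝ (Fin d)) :=
  volume.withDensity fun x =>
    ENNReal.ofReal ((stdGaussianDensity d x + stdGaussianDensity d (x - m)) / 2)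

/-- `μ`-average of `η` over the Euclidean ball `B(x,r)`. -/
noncomputable def gaussEtaBar (d : ℕ) (m : EuclideanSpace ℝ (Fin d))
    (x : EuclideanSpace ℝ (Fin d)) (r : ℝ) : ℝ :=
  ((gaussMixture d m (Metric.ball x r)).toReal)⁻¹ *
    ∫ y in Metric.ball x r, gaussEta d m y ∂(gaussMixture d m)

theorem stdGaussianDensity_pos (d : ℕ) (x : EuclideanSpace ℝ (Fin d)) :
    0 < stdGaussianDensity d x := by
  unfold stdGaussianDensity; positivity

@[fun_prop]
theorem continuous_stdGaussianDensity (d : ℕ) : Continuous (stdGaussianDensity d) := by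
  unfold stdGaussianDensity; fun_prop

theorem Continuous.integrableOn_metric_ball {d : ℕ} {f : EuclideanSpace ℝ (Fin d) → ℝ}
    (hf : Continuous f) (x : EuclideanSpace ℝ (Fin d)) (r : ℝ) :
    IntegrableOn f (Metric.ball x r) :=
  (hf.continuousOn.integrableOn_compact (isCompact_closedBall x r)).mono_set
    Metric.ball_subset_closedBall

/-- The Gaussian mass of a ball of radius `r` centred at `a`, relative to the density at `a`. -/
noncomputable def relativeBallMass {d : ℕ} (a : EuclideanSpace ℝ (Fin d)) (r : ℝ) : ℝ :=
  ∫ z in Metric.ball (0 : EuclideanSpace ℝ (Fin d)) r,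
    Real.exp (-‖z‖ ^ 2 / 2) * Real.cosh (inner ℝ a z)

theorem setIntegral_ball_translate {d : ℕ} (f : EuclideanSpace ℝ (Fin d) → ℝ)
    (x : EuclideanSpace ℝ (Fin d)) (r : ℝ) :
    ∫ y in Metric.ball x r, f y = ∫ z in Metric.ball 0 r, f (z + x) := by
  have h := (measurePreserving_add_right volume x).setIntegral_preimage_emb
    (measurableEmbedding_addRight x) f (Metric.ball x r)
  rw [← h]
  congr 2
  ext z
  simp [Metric.mem_ball, dist_eq_norm]

theorem setIntegral_ball_zero_neg {d : ℕ} (f : EuclideanSpace ℝ (Fin d) → ℝ) (r : ℝ) :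
    ∫ z in Metric.ball 0 r, f (-z) = ∫ z in Metric.ball 0 r, f z := by
  have h := (Measure.measurePreserving_neg
    (volume : Measure (EuclideanSpace ℝ (Fin d)))).setIntegral_preimage_emb
    (MeasurableEquiv.neg _).measurableEmbedding f (Metric.ball 0 r)
  rw [← h]
  congr 2
  ext z
  simp

theorem setIntegral_ball_stdGaussianDensity {d : ℕ} (b x : EuclideanSpace ℝ (Fin d)) (r : ℝ) :
    ∫ y in Metric.ball x r, stdGaussianDensity d (y - b)
      = stdGaussianDensity d (x - b) * relativeBallMass (x - b) r := by
  set a := x - b with ha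
  have hsplit (z : EuclideanSpace ℝ (Fin d)) : stdGaussianDensity d (z + x - b)
      = stdGaussianDensity d a * (Real.exp (-‖z‖ ^ 2 / 2) * Real.exp (-inner ℝ a z)) := by
    have : z + x - b = z + a := by rw [ha]; abel
    rw [this, stdGaussianDensity, stdGaussianDensity, norm_add_sq_real, mul_assoc, ← Real.exp_add,
      ← Real.exp_add, real_inner_comm z a]
    ring_nf
  rw [setIntegral_ball_translate]
  simp_rw [hsplit]
  rw [integral_const_mul]
  congr 1
  set f : EuclideanSpace ℝ (Fin d) → ℝ :=
    fun z => Real.exp (-‖z‖ ^ 2 / 2) * Real.exp (-inner ℝ a z) with hf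
  have hneg := setIntegral_ball_zero_neg f r
  have hcont : Continuous f := by rw [hf]; fun_prop
  have hcont_neg : Continuous fun z => f (-z) := hcont.comp continuous_neg
  have hcosh : relativeBallMass a r
      = ∫ z in Metric.ball (0 : EuclideanSpace ℝ (Fin d)) r, (f z + f (-z)) / 2 := by
    unfold relativeBallMass
    congr 1 with z
    simp only [hf, norm_neg, inner_neg_right, neg_neg, Real.cosh_eq]
    ring
  rw [hcosh, integral_div, integral_add (hcont.integrableOn_metric_ball 0 r)
    (hcont_neg.integrableOn_metric_ball 0 r), hneg]
  ring

theorem relativeBallMass_zero_le {d : ℕ} (a : EuclideanSpace ℝ (Fin d)) (r : ℝ) :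
    relativeBallMass (0 : EuclideanSpace ℝ (Fin d)) r ≤ relativeBallMass a r := by
  unfold relativeBallMass
  refine integral_mono
    (Continuous.integrableOn_metric_ball (by fun_prop) 0 r)
    (Continuous.integrableOn_metric_ball (by fun_prop) 0 r) fun z => ?_
  simp only [inner_zero_left, Real.cosh_zero]
  gcongr
  exact Real.one_le_cosh _

theorem Real.cosh_le_one_add_sq {t : ℝ} (ht : t ^ 2 ≤ 1) : Real.cosh t ≤ 1 + t ^ 2 := by
  have h1 := Real.cosh_le_exp_half_sq t
  have h2 := Real.abs_exp_sub_one_le (x := t ^ 2 / 2)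
    (by rw [abs_of_nonneg (by positivity)]; linarith)
  rw [abs_of_nonneg (by positivity : 0 ≤ t ^ 2 / 2)] at h2
  linarith [(abs_le.mp h2).2]

theorem relativeBallMass_le {d : ℕ} (a : EuclideanSpace ℝ (Fin d)) (r : ℝ) {s : ℝ}
    (has : ‖a‖ ^ 2 * r ^ 2 ≤ s) (hs : s ≤ 1) :
    relativeBallMass a r ≤ (1 + s) * relativeBallMass (0 : EuclideanSpace ℝ (Fin d)) r := by
  unfold relativeBallMass
  rw [← integral_const_mul]
  refine setIntegral_mono_on
    (Continuous.integrableOn_metric_ball (by fun_prop) 0 r)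
    (Continuous.integrableOn_metric_ball (by fun_prop) 0 r) measurableSet_ball fun z hz => ?_
  rw [mem_ball_zero_iff] at hz
  have hinner : (inner ℝ a z) ^ 2 ≤ s := by
    refine le_trans ?_ has
    rw [← mul_pow, ← sq_abs]
    gcongr
    exact (abs_real_inner_le_norm a z).trans (by gcongr)
  have hcosh := Real.cosh_le_one_add_sq (hinner.trans hs)
  simp only [inner_zero_left, Real.cosh_zero, mul_one]
  rw [mul_comm]
  gcongr
  linarith

theorem exp_mul_volume_ball_le_relativeBallMass {d : ℕ} (r : ℝ) :
    Real.exp (-r ^ 2 / 2) * volume.real (Metric.ball (0 : EuclideanSpace ℝ (Fin d)) r)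
      ≤ relativeBallMass (0 : EuclideanSpace ℝ (Fin d)) r := by
  unfold relativeBallMass
  have hconst : Real.exp (-r ^ 2 / 2) * volume.real (Metric.ball (0 : EuclideanSpace ℝ (Fin d)) r)
      = ∫ _ in Metric.ball (0 : EuclideanSpace ℝ (Fin d)) r, Real.exp (-r ^ 2 / 2) := by
    rw [setIntegral_const, smul_eq_mul, mul_comm]
  rw [hconst]
  refine setIntegral_mono_on
    (Continuous.integrableOn_metric_ball (by fun_prop) 0 r)
    (Continuous.integrableOn_metric_ball (by fun_prop) 0 r) measurableSet_ball fun z hz => ?_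
  rw [mem_ball_zero_iff] at hz
  simp only [inner_zero_left, Real.cosh_zero, mul_one]
  gcongr

theorem Real.Gamma_half_add_one_le (d : ℕ) :
    Real.Gamma ((d : ℝ) / 2 + 1) ≤ (d : ℝ) ^ ((d : ℝ) / 2) := by
  have h := Real.Gamma_mul_add_mul_le_rpow_Gamma_mul_rpow_Gamma (s := 1) (t := (d : ℝ) + 1)
    (a := 1 / 2) (b := 1 / 2) (by norm_num) (by positivity) (by norm_num) (by norm_num)
    (by norm_num)
  rw [Real.Gamma_one, Real.one_rpow, one_mul, Real.Gamma_nat_eq_factorial] at h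
  calc Real.Gamma ((d : ℝ) / 2 + 1) = Real.Gamma (1 / 2 * 1 + 1 / 2 * ((d : ℝ) + 1)) := by
        congr 1; ring
    _ ≤ (d.factorial : ℝ) ^ (1 / 2 : ℝ) := h
    _ ≤ ((d : ℝ) ^ d) ^ (1 / 2 : ℝ) := by
        gcongr
        exact_mod_cast Nat.factorial_le_pow d
    _ = (d : ℝ) ^ ((d : ℝ) / 2) := by
        rw [← Real.rpow_natCast, ← Real.rpow_mul (by positivity)]
        congr 1; ring

theorem rpow_le_volume_ball {d : ℕ} (hd : 1 ≤ d) {r : ℝ} (hr : 0 < r) :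
    (π * r ^ 2 / d) ^ ((d : ℝ) / 2)
      ≤ volume.real (Metric.ball (0 : EuclideanSpace ℝ (Fin d)) r) := by
  have : Nonempty (Fin d) := ⟨⟨0, hd⟩⟩
  have hd' : (0 : ℝ) < d := by exact_mod_cast hd
  have hΓ : 0 < Real.Gamma ((d : ℝ) / 2 + 1) := Real.Gamma_pos_of_pos (by positivity)
  rw [Measure.real, EuclideanSpace.volume_ball, Fintype.card_fin, ENNReal.toReal_mul,
    ENNReal.toReal_pow, ENNReal.toReal_ofReal hr.le, ENNReal.toReal_ofReal (by positivity),
    Real.div_rpow (by positivity) (by positivity), ← mul_div_assoc, ← mul_pow]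
  have hnum : (π * r ^ 2) ^ ((d : ℝ) / 2) = (r * √π) ^ d := by
    have hsq : π * r ^ 2 = (r * √π) ^ 2 := by
      rw [mul_pow, Real.sq_sqrt Real.pi_pos.le, mul_comm]
    rw [hsq, ← Real.rpow_natCast, ← Real.rpow_mul (by positivity), ← Real.rpow_natCast]
    congr 1
    push_cast
    ring
  rw [hnum]
  gcongr
  exact Real.Gamma_half_add_one_le d

theorem gaussMixture_ball_toReal {d : ℕ} (m x : EuclideanSpace ℝ (Fin d)) (r : ℝ) :
    (gaussMixture d m (Metric.ball x r)).toReal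
      = (stdGaussianDensity d x * relativeBallMass x r
        + stdGaussianDensity d (x - m) * relativeBallMass (x - m) r) / 2 := by
  have h0 := setIntegral_ball_stdGaussianDensity 0 x r
  simp only [sub_zero] at h0
  rw [← h0, ← setIntegral_ball_stdGaussianDensity, gaussMixture,
    withDensity_apply _ measurableSet_ball,
    ← integral_eq_lintegral_of_nonneg_ae, integral_div, integral_add]
  · exact Continuous.integrableOn_metric_ball (by fun_prop) x r
  · exact Continuous.integrableOn_metric_ball (by fun_prop) x r
  · refine Filter.Eventually.of_forall fun y => ?_
    have := stdGaussianDensity_pos d y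
    have := stdGaussianDensity_pos d (y - m)
    simp only [Pi.zero_apply]
    positivity
  · exact Continuous.aestronglyMeasurable (by fun_prop)

theorem setIntegral_gaussEta {d : ℕ} (m x : EuclideanSpace ℝ (Fin d)) (r : ℝ) :
    ∫ y in Metric.ball x r, gaussEta d m y ∂(gaussMixture d m)
      = stdGaussianDensity d (x - m) * relativeBallMass (x - m) r / 2 := by
  rw [← setIntegral_ball_stdGaussianDensity, gaussMixture,
    setIntegral_withDensity_eq_setIntegral_toReal_smul (by fun_prop) (by simp) _
      measurableSet_ball, ← integral_div]
  congr 1 with y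
  have := stdGaussianDensity_pos d y
  have := stdGaussianDensity_pos d (y - m)
  rw [ENNReal.toReal_ofReal (by positivity), smul_eq_mul, gaussEta]
  field_simp

theorem abs_weighted_ratio_sub_le {p q A C G s : ℝ} (hp : 0 < p) (hq : 0 < q) (hG : 0 < G)
    (hA : G ≤ A) (hC : G ≤ C) (hs : 0 ≤ s) (hA' : s ≤ 1 → A ≤ (1 + s) * G)
    (hC' : s ≤ 1 → C ≤ (1 + s) * G) :
    |q * C / (p * A + q * C) - q / (p + q)| ≤ s := by
  have hA0 : 0 < A := hG.trans_le hA
  have hC0 : 0 < C := hG.trans_le hC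
  have hpA : 0 < p * A := by positivity
  have hqC : 0 < q * C := by positivity
  rcases le_total s 1 with h | h
  · have hden : (p + q) * G ≤ p * A + q * C := by nlinarith
    have hCA : |C - A| ≤ s * G := abs_le.mpr ⟨by linarith [hA' h], by linarith [hC' h]⟩
    have heq : q * C / (p * A + q * C) - q / (p + q)
        = p * q * (C - A) / ((p * A + q * C) * (p + q)) := by
      field_simp
      ring
    rw [heq, abs_div, abs_mul, abs_of_pos (by positivity : 0 < p * q),
      abs_of_pos (by positivity : 0 < (p * A + q * C) * (p + q)), div_le_iff₀ (by positivity)]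
    calc p * q * |C - A| ≤ p * q * (s * G) := by gcongr
      _ ≤ (p + q) * (p + q) * (s * G) := by gcongr <;> linarith
      _ = s * ((p + q) * G * (p + q)) := by ring
      _ ≤ s * ((p * A + q * C) * (p + q)) := by gcongr
  · have h1 : 0 ≤ q * C / (p * A + q * C) := by positivity
    have h2 : q * C / (p * A + q * C) ≤ 1 := (div_le_one (by positivity)).mpr (by linarith)
    have h3 : 0 ≤ q / (p + q) := by positivity
    have h4 : q / (p + q) ≤ 1 := (div_le_one (by positivity)).mpr (by linarith)
    exact abs_le.mpr ⟨by linarith, by linarith⟩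

theorem relativeBallMass_zero_pos {d : ℕ} {r : ℝ} (hr : 0 < r) :
    0 < relativeBallMass (0 : EuclideanSpace ℝ (Fin d)) r := by
  refine lt_of_lt_of_le ?_ (exp_mul_volume_ball_le_relativeBallMass r)
  have : 0 < volume.real (Metric.ball (0 : EuclideanSpace ℝ (Fin d)) r) :=
    ENNReal.toReal_pos (Metric.measure_ball_pos volume 0 hr).ne' measure_ball_lt_top.ne
  positivity

theorem abs_gaussEtaBar_sub_gaussEta_le {d : ℕ} (m x : EuclideanSpace ℝ (Fin d)) {r : ℝ}
    (hr : 0 < r) :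
    |gaussEtaBar d m x r - gaussEta d m x| ≤ (‖x - m‖ ^ 2 + ‖x‖ ^ 2) * r ^ 2 := by
  have hp := stdGaussianDensity_pos d x
  have hq := stdGaussianDensity_pos d (x - m)
  have hG := relativeBallMass_zero_pos (d := d) hr
  have hA := relativeBallMass_zero_le x r
  have hC := relativeBallMass_zero_le (x - m) r
  have hbar : gaussEtaBar d m x r
      = stdGaussianDensity d (x - m) * relativeBallMass (x - m) r /
        (stdGaussianDensity d x * relativeBallMass x r
          + stdGaussianDensity d (x - m) * relativeBallMass (x - m) r) := by
    rw [gaussEtaBar, gaussMixture_ball_toReal, setIntegral_gaussEta]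
    field_simp
  rw [hbar, gaussEta]
  refine abs_weighted_ratio_sub_le hp hq hG hA hC (by positivity)
    (relativeBallMass_le x r ?_) (relativeBallMass_le (x - m) r ?_)
  · gcongr
    linarith [sq_nonneg ‖x - m‖]
  · gcongr
    linarith [sq_nonneg ‖x‖]

theorem sq_le_mul_gaussMixture_ball_rpow {d : ℕ} (hd : 1 ≤ d) (m x : EuclideanSpace ℝ (Fin d))
    {r : ℝ} (hr : 0 < r) :
    π * r ^ 2 ≤ d * Real.exp (r ^ 2 / d) *
      (((stdGaussianDensity d x)⁻¹ + (stdGaussianDensity d (x - m))⁻¹) ^ (2 / (d : ℝ)) *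
        (gaussMixture d m (Metric.ball x r)).toReal ^ (2 / (d : ℝ))) := by
  have hd' : (0 : ℝ) < d := by exact_mod_cast hd
  have hp := stdGaussianDensity_pos d x
  have hq := stdGaussianDensity_pos d (x - m)
  have hG := relativeBallMass_zero_pos (d := d) hr
  have hA := relativeBallMass_zero_le x r
  have hC := relativeBallMass_zero_le (x - m) r
  have hlower : Real.exp (-r ^ 2 / 2) * (π * r ^ 2 / d) ^ ((d : ℝ) / 2)
      ≤ ((stdGaussianDensity d x)⁻¹ + (stdGaussianDensity d (x - m))⁻¹) *
        (gaussMixture d m (Metric.ball x r)).toReal := by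
    refine (mul_le_mul_of_nonneg_left (rpow_le_volume_ball hd hr) (Real.exp_nonneg _)).trans
      ((exp_mul_volume_ball_le_relativeBallMass r).trans ?_)
    rw [gaussMixture_ball_toReal]
    generalize stdGaussianDensity d x = p at *
    generalize stdGaussianDensity d (x - m) = q at *
    generalize relativeBallMass x r = A at *
    generalize relativeBallMass (x - m) r = C at *
    have hA0 := hG.trans_le hA
    have hC0 := hG.trans_le hC
    have hexp : (p⁻¹ + q⁻¹) * ((p * A + q * C) / 2)
        = (A + C) / 2 + (p / q * A + q / p * C) / 2 := by
      field_simp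
      ring
    have : 0 ≤ (p / q * A + q / p * C) / 2 := by positivity
    linarith
  have hpow := Real.rpow_le_rpow (by positivity) hlower (by positivity : 0 ≤ 2 / (d : ℝ))
  rw [Real.mul_rpow (by positivity) (by positivity), ← Real.exp_mul,
    ← Real.rpow_mul (by positivity), Real.mul_rpow (by positivity) ENNReal.toReal_nonneg,
    (by field_simp : (d : ℝ) / 2 * (2 / d) = 1), Real.rpow_one] at hpow
  calc π * r ^ 2 = d * Real.exp (r ^ 2 / d) *
        (Real.exp (-r ^ 2 / 2 * (2 / d)) * (π * r ^ 2 / d)) := by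
        have : -r ^ 2 / 2 * (2 / d) = -(r ^ 2 / d) := by ring
        rw [this, Real.exp_neg]
        field_simp
    _ ≤ _ := by gcongr

/-- Smoothness estimate concluding the proof of Proposition 4.1:
`|η̄(x,r) − η(x)| ≤ 12·d·e^{r²/d}·(‖x−m‖²+‖x‖²)·(γ_d(x)⁻¹+γ_d(x−m)⁻¹)^{2/d}·μ(B(x,r))^{2/d}`. -/
theorem etaBar_sub_eta_le_smoothness (d : ℕ) (hd : 1 ≤ d)
    (m : EuclideanSpace ℝ (Fin d)) (hm : m ≠ 0)
    (x : EuclideanSpace ℝ (Fin d)) (r : ℝ) (hr : 0 < r) :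
    |gaussEtaBar d m x r - gaussEta d m x|
      ≤ 12 * d * Real.exp (r ^ 2 / d) * (‖x - m‖ ^ 2 + ‖x‖ ^ 2) *
          ((stdGaussianDensity d x)⁻¹ + (stdGaussianDensity d (x - m))⁻¹) ^ (2 / (d : ℝ)) *
          ((gaussMixture d m (Metric.ball x r)).toReal) ^ (2 / (d : ℝ)) := by
  have hμ := sq_le_mul_gaussMixture_ball_rpow hd m x hr
  refine (abs_gaussEtaBar_sub_gaussEta_le m x hr).trans ?_
  have hle : r ^ 2 ≤ 12 * (π * r ^ 2) := by nlinarith [Real.pi_gt_three, sq_nonneg r]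
  calc (‖x - m‖ ^ 2 + ‖x‖ ^ 2) * r ^ 2
      ≤ (‖x - m‖ ^ 2 + ‖x‖ ^ 2) * (12 * (π * r ^ 2)) := by gcongr
    _ ≤ (‖x - m‖ ^ 2 + ‖x‖ ^ 2) * (12 * (d * Real.exp (r ^ 2 / d) *
        (((stdGaussianDensity d x)⁻¹ + (stdGaussianDensity d (x - m))⁻¹) ^ (2 / (d : ℝ)) *
          (gaussMixture d m (Metric.ball x r)).toReal ^ (2 / (d : ℝ))))) := by gcongr
    _ = _ := by ring
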